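/- arXiv:1803.04005 — 2 statements merged into one kernel-verified Lean document; each statement's English description precedes it below -/
import Mathlib

section
/- Let F = a·e_1³ + b·e_2³ + c·e_3³ + 3d·e_1²e_2 + 3p·e_1²e_3 + 3q·e_1e_2² + 3r·e_2²e_3 + 3s·e_1e_3² + 3t·e_2e_3² + 6u·e_1e_2e_3 be a ternary cubic, and let A_4(F) := abcu − bcdp − acqr − abst − u(art+bps+cdq) + aqt² + ar²s + bds² + bp²t + cd²r + cpq² − u⁴ + 2u²(qs+dt+pr) − 3u(drs+pqt) − q²s² − d²t² − p²r² + dprt + prqs + dqst be the degree four Aronhold invariant. Then A_4(F) ≠ 0 if and only if the subspace F^⊥ ∩ ℂ[z_1,z_2,z_3]_2 is 3-dimensional and admits a basis (f_1,f_2,f_3) whose only common zero in ℂ³ is the origin. -/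
open MvPolynomial

noncomputable section

/-- The partial derivative `∂/∂e_i` as a `ℂ`-linear endomorphism of `ℂ[e_1,…,e_n]`. -/
def pdEnd (n : ℕ) (i : Fin n) : Module.End ℂ (MvPolynomial (Fin n) ℂ) :=
  (pderiv i).toLinearMap

/-- The polar pairing (apolarity action) `g ⋄ F := g(∂/∂e_1,…,∂/∂e_n) F`. -/
def diamond {n : ℕ} (g F : MvPolynomial (Fin n) ℂ) : MvPolynomial (Fin n) ℂ :=
  ∑ m ∈ g.support, g.coeff m • ((List.ofFn fun i => pdEnd n i ^ m i).prod F)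

end

open Matrix

section Matrices

/-- A pencil of square matrices over an algebraically closed field has a singular member. -/
theorem exists_det_smul_add_smul_eq_zero {K n : Type*} [Field K] [IsAlgClosed K] [Fintype n]
    [DecidableEq n] [Nonempty n] (A B : Matrix n n K) :
    ∃ x y : K, (x ≠ 0 ∨ y ≠ 0) ∧ (x • A + y • B).det = 0 := by
  by_cases hA : A.det = 0
  · exact ⟨1, 0, by simp, by simpa using hA⟩
  obtain ⟨x, hx⟩ := spectrum.nonempty_of_isAlgClosed_of_finiteDimensional K (A⁻¹ * B)
  refine ⟨x, -1, by simp, ?_⟩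
  have hfac : x • A + (-1 : K) • B = A * (algebraMap K (Matrix n n K) x - A⁻¹ * B) := by
    rw [mul_sub, ← mul_assoc, mul_nonsing_inv _ (isUnit_iff_ne_zero.mpr hA), one_mul,
      ← Algebra.commutes, Algebra.smul_def, neg_one_smul, sub_eq_add_neg]
  have hdet : (algebraMap K (Matrix n n K) x - A⁻¹ * B).det = 0 := by
    by_contra h
    exact hx ((isUnit_iff_isUnit_det _).mpr (isUnit_iff_ne_zero.mpr h))
  rw [hfac, det_mul, hdet, mul_zero]

theorem isSymm_sum_smul {ι n R : Type*} [Fintype ι] [CommSemiring R] {M : ι → Matrix n n R}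
    (hM : ∀ k, (M k).IsSymm) (w : ι → R) : (∑ k, w k • M k).IsSymm := by
  simp only [IsSymm, transpose_sum, transpose_smul, (hM _).eq]

/-- A symmetric complex `3 × 3` matrix of rank at most one is the square of a vector. -/
theorem exists_eq_vecMulVec_self_of_adjugate_eq_zero {A : Matrix (Fin 3) (Fin 3) ℂ}
    (hA : A.IsSymm) (hadj : A.adjugate = 0) : ∃ v : Fin 3 → ℂ, vecMulVec v v = A := by
  have h01 : A 1 0 = A 0 1 := hA.apply 0 1
  have h02 : A 2 0 = A 0 2 := hA.apply 0 2
  have h12 : A 2 1 = A 1 2 := hA.apply 1 2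
  have hm (i j : Fin 3) : A.adjugate i j = 0 := by rw [hadj]; rfl
  have m00 := hm 0 0
  have m11 := hm 1 1
  have m22 := hm 2 2
  have m01 := hm 0 1
  have m02 := hm 0 2
  have m12 := hm 1 2
  simp only [adjugate_fin_three, of_apply, cons_val, h01, h02, h12] at m00 m11 m22 m01 m02 m12
  suffices ∃ x y z : ℂ, x * x = A 0 0 ∧ y * y = A 1 1 ∧ z * z = A 2 2 ∧
      x * y = A 0 1 ∧ x * z = A 0 2 ∧ y * z = A 1 2 by
    obtain ⟨x, y, z, hxx, hyy, hzz, hxy, hxz, hyz⟩ := this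
    refine ⟨![x, y, z], ?_⟩
    ext i j
    fin_cases i <;> fin_cases j <;>
      simp [vecMulVec_apply, hxx, hyy, hzz, hxy, hxz, hyz, h01, h02, h12, mul_comm y x,
        mul_comm z x, mul_comm z y]
  obtain ⟨x, hx⟩ := IsAlgClosed.exists_eq_mul_self (A 0 0)
  by_cases hx0 : x = 0
  · have e00 : A 0 0 = 0 := by simp [hx, hx0]
    have e01 : A 0 1 = 0 := mul_self_eq_zero.mp (by linear_combination A 1 1 * e00 - m22)
    have e02 : A 0 2 = 0 := mul_self_eq_zero.mp (by linear_combination A 2 2 * e00 - m11)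
    obtain ⟨y, hy⟩ := IsAlgClosed.exists_eq_mul_self (A 1 1)
    by_cases hy0 : y = 0
    · have e11 : A 1 1 = 0 := by simp [hy, hy0]
      have e12 : A 1 2 = 0 := mul_self_eq_zero.mp (by linear_combination A 2 2 * e11 - m00)
      obtain ⟨z, hz⟩ := IsAlgClosed.exists_eq_mul_self (A 2 2)
      exact ⟨0, 0, z, by simp [e00], by simp [e11], hz.symm, by simp [e01], by simp [e02],
        by simp [e12]⟩
    · refine ⟨0, y, A 1 2 / y, by simp [e00], hy.symm, ?_, by simp [e01], by simp [e02], ?_⟩ <;>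
        field_simp
      linear_combination A 2 2 * hy - m00
  · refine ⟨x, A 0 1 / x, A 0 2 / x, hx.symm, ?_, ?_, ?_, ?_, ?_⟩ <;> field_simp
    · linear_combination A 1 1 * hx - m22
    · linear_combination A 2 2 * hx - m11
    · linear_combination A 1 2 * hx + m12

end Matrices

section PolarNet

/-- The matrices of the three partial derivatives of a ternary cubic, up to the factor `3`. -/
def polarNet (a b c d p q r s t u : ℂ) : Fin 3 → Matrix (Fin 3) (Fin 3) ℂ :=
  ![!![a, d, p; d, q, u; p, u, s], !![d, q, u; q, b, r; u, r, t], !![p, u, s; u, r, t; s, t, c]]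

/-- The degree four Aronhold invariant of a ternary cubic. -/
def aronholdInvariant (a b c d p q r s t u : ℂ) : ℂ :=
  a * b * c * u - b * c * d * p - a * c * q * r - a * b * s * t
    - u * (a * r * t + b * p * s + c * d * q)
    + a * q * t ^ 2 + a * r ^ 2 * s + b * d * s ^ 2 + b * p ^ 2 * t
    + c * d ^ 2 * r + c * p * q ^ 2 - u ^ 4
    + 2 * u ^ 2 * (q * s + d * t + p * r)
    - 3 * u * (d * r * s + p * q * t)
    - q ^ 2 * s ^ 2 - d ^ 2 * t ^ 2 - p ^ 2 * r ^ 2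
    + d * p * r * t + p * r * q * s + d * q * s * t

variable (a b c d p q r s t u : ℂ)

theorem polarNet_isSymm (k : Fin 3) : (polarNet a b c d p q r s t u k).IsSymm := by
  ext i j
  fin_cases k <;> fin_cases i <;> fin_cases j <;> rfl

/-- The quadratic map `w ↦ adj M(w)` induces a linear endomorphism of the space of symmetric
matrices whose square is the scalar `-A₄`. -/
theorem adjugate_sum_smul_polarNet {v w : Fin 3 → ℂ}
    (hvw : vecMulVec v v = (∑ k, w k • polarNet a b c d p q r s t u k).adjugate) :
    (∑ k, v k • polarNet a b c d p q r s t u k).adjugate =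
      -aronholdInvariant a b c d p q r s t u • vecMulVec w w := by
  have h (i j : Fin 3) := congrFun (congrFun hvw i) j
  have h00 := h 0 0
  have h01 := h 0 1
  have h02 := h 0 2
  have h11 := h 1 1
  have h12 := h 1 2
  have h22 := h 2 2
  simp only [vecMulVec_apply, Fin.sum_univ_three, polarNet, cons_val, adjugate_fin_three, smul_of,
    smul_cons, smul_eq_mul, smul_empty, add_cons, of_add_of, empty_add_empty, of_apply, head_cons,
    tail_cons] at h00 h01 h02 h11 h12 h22 ⊢
  ext i j
  fin_cases i <;> fin_cases j <;>
    simp only [vecMulVec_apply, of_apply, cons_val, Matrix.smul_apply, smul_eq_mul,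
      aronholdInvariant, Fin.zero_eta, Fin.mk_one, Fin.reduceFinMk]
  · linear_combination (q * s - (u * u)) * h00
      + (q * t + b * s - (u * r + r * u)) * h01
      + (q * c + r * s - (u * t + t * u)) * h02
      + (b * t - (r * r)) * h11
      + (b * c + r * t - (r * t + t * r)) * h12
      + (r * c - (t * t)) * h22
  · linear_combination (p * u - (d * s)) * h00
      + (p * r + u * u - (d * t + q * s)) * h01
      + (p * t + s * u - (d * c + u * s)) * h02
      + (u * r - (q * t)) * h11
      + (u * t + s * r - (q * c + u * t)) * h12
      + (s * t - (u * c)) * h22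
  · linear_combination (d * u - (p * q)) * h00
      + (d * r + q * u - (p * b + u * q)) * h01
      + (d * t + u * u - (p * r + s * q)) * h02
      + (q * r - (u * b)) * h11
      + (q * t + u * r - (u * r + s * b)) * h12
      + (u * t - (s * r)) * h22
  · linear_combination (u * p - (d * s)) * h00
      + (u * u + r * p - (d * t + q * s)) * h01
      + (u * s + t * p - (d * c + u * s)) * h02
      + (r * u - (q * t)) * h11
      + (r * s + t * u - (q * c + u * t)) * h12
      + (t * s - (u * c)) * h22
  · linear_combination (a * s - (p * p)) * h00
      + (a * t + d * s - (p * u + u * p)) * h01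
      + (a * c + p * s - (p * s + s * p)) * h02
      + (d * t - (u * u)) * h11
      + (d * c + p * t - (u * s + s * u)) * h12
      + (p * c - (s * s)) * h22
  · linear_combination (p * d - (a * u)) * h00
      + (p * q + u * d - (a * r + d * u)) * h01
      + (p * u + s * d - (a * t + p * u)) * h02
      + (u * q - (d * r)) * h11
      + (u * u + s * q - (d * t + p * r)) * h12
      + (s * u - (p * t)) * h22
  · linear_combination (d * u - (q * p)) * h00
      + (d * r + q * u - (q * u + b * p)) * h01
      + (d * t + u * u - (q * s + r * p)) * h02
      + (q * r - (b * u)) * h11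
      + (q * t + u * r - (b * s + r * u)) * h12
      + (u * t - (r * s)) * h22
  · linear_combination (d * p - (a * u)) * h00
      + (d * u + q * p - (a * r + d * u)) * h01
      + (d * s + u * p - (a * t + p * u)) * h02
      + (q * u - (d * r)) * h11
      + (q * s + u * u - (d * t + p * r)) * h12
      + (u * s - (p * t)) * h22
  · linear_combination (a * q - (d * d)) * h00
      + (a * b + d * q - (d * q + q * d)) * h01
      + (a * r + p * q - (d * u + u * d)) * h02
      + (d * b - (q * q)) * h11
      + (d * r + p * b - (q * u + u * q)) * h12
      + (p * r - (u * u)) * h22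

theorem aronholdInvariant_ne_zero_iff :
    aronholdInvariant a b c d p q r s t u ≠ 0 ↔
      ∀ w : Fin 3 → ℂ, (∑ k, w k • polarNet a b c d p q r s t u k).adjugate = 0 → w = 0 := by
  constructor
  · intro hA w hw
    have h := adjugate_sum_smul_polarNet a b c d p q r s t u (v := 0) (w := w) (by simp [hw])
    have h0 : vecMulVec w w = 0 := by simpa [hA] using h.symm
    funext i
    simpa [vecMulVec_apply] using congrFun (congrFun h0 i) i
  · intro hw hA
    obtain ⟨x, y, hxy, hdet⟩ := exists_det_smul_add_smul_eq_zero
      (polarNet a b c d p q r s t u 0) (polarNet a b c d p q r s t u 1)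
    set w : Fin 3 → ℂ := ![x, y, 0] with hw_def
    set M := ∑ k, w k • polarNet a b c d p q r s t u k with hM
    have hMdet : M.det = 0 := by simpa [hM, hw_def, Fin.sum_univ_three] using hdet
    have hMsymm : M.IsSymm := isSymm_sum_smul (polarNet_isSymm a b c d p q r s t u) w
    have hadj : M.adjugate.adjugate = 0 := by
      rw [adjugate_adjugate M (by simp), hMdet]; simp
    have hadj_symm : M.adjugate.IsSymm := by
      rw [IsSymm, adjugate_transpose, hMsymm.eq]
    obtain ⟨v, hv⟩ := exists_eq_vecMulVec_self_of_adjugate_eq_zero hadj_symm hadj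
    have hv0 : v = 0 := hw v (by rw [adjugate_sum_smul_polarNet a b c d p q r s t u hv, hA]; simp)
    have hw0 : w = 0 := hw w (by rw [← hM, ← hv, hv0]; simp)
    have hx : x = 0 := congrFun hw0 0
    have hy : y = 0 := congrFun hw0 1
    simp [hx, hy] at hxy

end PolarNet

section Quadrics

/-- The ternary quadratic form with given coefficients. -/
noncomputable def ternaryQuadric : (Fin 6 → ℂ) →ₗ[ℂ] MvPolynomial (Fin 3) ℂ :=
  Fintype.linearCombination ℂ
    ![X 0 * X 0, X 1 * X 1, X 2 * X 2, X 0 * X 1, X 0 * X 2, X 1 * X 2]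

theorem ternaryQuadric_apply (x : Fin 6 → ℂ) :
    ternaryQuadric x = x 0 • (X 0 * X 0) + x 1 • (X 1 * X 1) + x 2 • (X 2 * X 2)
      + x 3 • (X 0 * X 1) + x 4 • (X 0 * X 2) + x 5 • (X 1 * X 2) := by
  simp [ternaryQuadric, Fintype.linearCombination_apply, Fin.sum_univ_succ]
  abel

theorem X_mul_X_eq_monomial {σ R : Type*} [CommSemiring R] (i j : σ) :
    (X i * X j : MvPolynomial σ R) =
      monomial (Finsupp.single i 1 + Finsupp.single j 1) 1 := by
  simp [X, monomial_mul]

theorem ternaryQuadric_isHomogeneous (x : Fin 6 → ℂ) : (ternaryQuadric x).IsHomogeneous 2 := by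
  have h (i j : Fin 3) (y : ℂ) : (y • (X i * X j) : MvPolynomial (Fin 3) ℂ).IsHomogeneous 2 :=
    (homogeneousSubmodule (Fin 3) ℂ 2).smul_mem y ((isHomogeneous_X ℂ i).mul (isHomogeneous_X ℂ j))
  rw [ternaryQuadric_apply]
  exact (((((h _ _ _).add (h _ _ _)).add (h _ _ _)).add (h _ _ _)).add (h _ _ _)).add (h _ _ _)

theorem coeff_ternaryQuadric (x : Fin 6 → ℂ) (m : Fin 3 →₀ ℕ) :
    coeff m (ternaryQuadric x) =
      (if m 0 = 2 ∧ m 1 = 0 ∧ m 2 = 0 then x 0 else 0)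
      + (if m 0 = 0 ∧ m 1 = 2 ∧ m 2 = 0 then x 1 else 0)
      + (if m 0 = 0 ∧ m 1 = 0 ∧ m 2 = 2 then x 2 else 0)
      + (if m 0 = 1 ∧ m 1 = 1 ∧ m 2 = 0 then x 3 else 0)
      + (if m 0 = 1 ∧ m 1 = 0 ∧ m 2 = 1 then x 4 else 0)
      + (if m 0 = 0 ∧ m 1 = 1 ∧ m 2 = 1 then x 5 else 0) := by
  simp [ternaryQuadric_apply, X_mul_X_eq_monomial, coeff_monomial, Finsupp.ext_iff,
    Fin.forall_fin_succ, Finsupp.single_apply, eq_comm (b := m _)]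

theorem ternaryQuadric_injective : Function.Injective ternaryQuadric := by
  rw [← LinearMap.ker_eq_bot, LinearMap.ker_eq_bot']
  intro x hx
  have h (m : Fin 3 → ℕ) : coeff (Finsupp.equivFunOnFinite.symm m) (ternaryQuadric x) = 0 := by
    simp [hx]
  simp only [coeff_ternaryQuadric, Finsupp.equivFunOnFinite_symm_apply_apply] at h
  have h0 := h ![2, 0, 0]
  have h1 := h ![0, 2, 0]
  have h2 := h ![0, 0, 2]
  have h3 := h ![1, 1, 0]
  have h4 := h ![1, 0, 1]
  have h5 := h ![0, 1, 1]
  simp at h0 h1 h2 h3 h4 h5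
  funext i
  fin_cases i <;> simp [*]

theorem MvPolynomial.IsHomogeneous.exists_ternaryQuadric_eq {g : MvPolynomial (Fin 3) ℂ}
    (hg : g.IsHomogeneous 2) : ∃ x, ternaryQuadric x = g := by
  set e : (Fin 3 → ℕ) → ℂ := fun m => coeff (Finsupp.equivFunOnFinite.symm m) g with he
  refine ⟨![e ![2, 0, 0], e ![0, 2, 0], e ![0, 0, 2], e ![1, 1, 0], e ![1, 0, 1], e ![0, 1, 1]], ?_⟩
  ext m
  by_cases hm : m.degree = 2
  · obtain ⟨m, rfl⟩ := Finsupp.equivFunOnFinite.symm.surjective m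
    obtain ⟨i, j, k, rfl⟩ : ∃ i j k, m = ![i, j, k] :=
      ⟨m 0, m 1, m 2, by ext i; fin_cases i <;> rfl⟩
    have hsum : i + j + k = 2 := by
      simpa [Finsupp.degree_eq_sum, Fin.sum_univ_three] using hm
    obtain ⟨hi, hj⟩ : i ≤ 2 ∧ j ≤ 2 := by omega
    obtain rfl : k = 2 - i - j := by omega
    rw [coeff_ternaryQuadric]
    interval_cases i <;> interval_cases j <;> simp_all
  · rw [hg.coeff_eq_zero hm, (ternaryQuadric_isHomogeneous _).coeff_eq_zero hm]

/-- The apolarity pairing between matrices and ternary quadratic forms; on a symmetric matrix it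
uses all six independent entries. -/
noncomputable def quadricPairing :
    Matrix (Fin 3) (Fin 3) ℂ →ₗ[ℂ] Module.Dual ℂ (Fin 6 → ℂ) :=
  LinearMap.mk₂ ℂ
    (fun A x => A 0 0 * x 0 + A 1 1 * x 1 + A 2 2 * x 2
      + A 0 1 * x 3 + A 0 2 * x 4 + A 1 2 * x 5)
    (fun A B x => by simp only [Matrix.add_apply]; ring)
    (fun y A x => by simp only [Matrix.smul_apply, smul_eq_mul]; ring)
    (fun A x y => by simp only [Pi.add_apply]; ring)
    (fun y A x => by simp only [Pi.smul_apply, smul_eq_mul]; ring)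

theorem quadricPairing_apply (A : Matrix (Fin 3) (Fin 3) ℂ) (x : Fin 6 → ℂ) :
    quadricPairing A x = A 0 0 * x 0 + A 1 1 * x 1 + A 2 2 * x 2
      + A 0 1 * x 3 + A 0 2 * x 4 + A 1 2 * x 5 :=
  rfl

theorem Matrix.IsSymm.ext_quadricPairing {A B : Matrix (Fin 3) (Fin 3) ℂ} (hA : A.IsSymm)
    (hB : B.IsSymm) (h : quadricPairing A = quadricPairing B) : A = B := by
  have hx (i : Fin 6) := LinearMap.congr_fun h (Pi.single i 1)
  simp only [quadricPairing_apply] at hx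
  have h0 := hx 0
  have h1 := hx 1
  have h2 := hx 2
  have h3 := hx 3
  have h4 := hx 4
  have h5 := hx 5
  simp at h0 h1 h2 h3 h4 h5
  ext i j
  fin_cases i <;> fin_cases j <;>
    simp [hA.apply 0 1, hA.apply 0 2, hA.apply 1 2, hB.apply 0 1, hB.apply 0 2, hB.apply 1 2, *]

theorem eval_ternaryQuadric (v : Fin 3 → ℂ) (x : Fin 6 → ℂ) :
    eval v (ternaryQuadric x) = quadricPairing (vecMulVec v v) x := by
  simp [ternaryQuadric_apply, quadricPairing_apply, vecMulVec_apply, smul_eval]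
  ring

end Quadrics

section Diamond

theorem diamond_eq_sum_of_subset {n : ℕ} {g : MvPolynomial (Fin n) ℂ} {S : Finset (Fin n →₀ ℕ)}
    (hS : g.support ⊆ S) (F : MvPolynomial (Fin n) ℂ) :
    diamond g F = ∑ m ∈ S, g.coeff m • ((List.ofFn fun i => pdEnd n i ^ m i).prod F) :=
  Finset.sum_subset hS fun m _ hm => by rw [notMem_support_iff.mp hm, zero_smul]

theorem diamond_add {n : ℕ} (g h F : MvPolynomial (Fin n) ℂ) :
    diamond (g + h) F = diamond g F + diamond h F := by
  classical
  rw [diamond_eq_sum_of_subset support_add F,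
    diamond_eq_sum_of_subset (S := g.support ∪ h.support) Finset.subset_union_left F,
    diamond_eq_sum_of_subset (S := g.support ∪ h.support) Finset.subset_union_right F,
    ← Finset.sum_add_distrib]
  exact Finset.sum_congr rfl fun m _ => by rw [coeff_add, add_smul]

theorem diamond_monomial {n : ℕ} (m : Fin n →₀ ℕ) (y : ℂ) (F : MvPolynomial (Fin n) ℂ) :
    diamond (monomial m y) F = y • ((List.ofFn fun i => pdEnd n i ^ m i).prod F) := by
  rw [diamond_eq_sum_of_subset support_monomial_subset, Finset.sum_singleton, coeff_monomial,
    if_pos rfl]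

theorem diamond_smul_X_mul_X {i j : Fin 3} (hij : i ≤ j) (y : ℂ) (F : MvPolynomial (Fin 3) ℂ) :
    diamond (y • (X i * X j)) F = y • pderiv i (pderiv j F) := by
  rw [X_mul_X_eq_monomial, smul_monomial, diamond_monomial]
  fin_cases i <;> fin_cases j <;> simp at hij <;>
    simp [pdEnd, List.ofFn_succ, Finsupp.single_apply, pow_two]

/-- The ternary cubic with the given coefficients. -/
noncomputable def ternaryCubic (a b c d p q r s t u : ℂ) : MvPolynomial (Fin 3) ℂ :=
  C a * X 0 ^ 3 + C b * X 1 ^ 3 + C c * X 2 ^ 3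
    + C (3 * d) * X 0 ^ 2 * X 1 + C (3 * p) * X 0 ^ 2 * X 2
    + C (3 * q) * X 0 * X 1 ^ 2 + C (3 * r) * X 1 ^ 2 * X 2
    + C (3 * s) * X 0 * X 2 ^ 2 + C (3 * t) * X 1 * X 2 ^ 2
    + C (6 * u) * X 0 * X 1 * X 2

variable (a b c d p q r s t u : ℂ)

theorem diamond_ternaryQuadric_ternaryCubic (x : Fin 6 → ℂ) :
    diamond (ternaryQuadric x) (ternaryCubic a b c d p q r s t u) =
      ∑ k, C (6 * quadricPairing (polarNet a b c d p q r s t u k) x) * X k := by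
  simp only [ternaryQuadric_apply, diamond_add]
  rw [diamond_smul_X_mul_X (by decide), diamond_smul_X_mul_X (by decide),
    diamond_smul_X_mul_X (by decide), diamond_smul_X_mul_X (by decide),
    diamond_smul_X_mul_X (by decide), diamond_smul_X_mul_X (by decide)]
  have hthree (i : Fin 3) : pderiv i (3 : MvPolynomial (Fin 3) ℂ) = 0 := (pderiv i).map_natCast 3
  have htwo (i : Fin 3) : pderiv i (2 : MvPolynomial (Fin 3) ℂ) = 0 := (pderiv i).map_natCast 2
  simp [ternaryCubic, Fin.sum_univ_three, quadricPairing_apply, polarNet, smul_eq_C_mul,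
    pderiv_X, hthree, htwo]
  simp only [map_ofNat]
  ring

theorem diamond_ternaryQuadric_ternaryCubic_eq_zero_iff (x : Fin 6 → ℂ) :
    diamond (ternaryQuadric x) (ternaryCubic a b c d p q r s t u) = 0 ↔
      ∀ k, quadricPairing (polarNet a b c d p q r s t u k) x = 0 := by
  rw [diamond_ternaryQuadric_ternaryCubic]
  refine ⟨fun h k => ?_, fun h => by simp [h]⟩
  simpa [Pi.single_apply] using congrArg (eval (Pi.single k 1)) h

end Diamond

section LinearSystem

variable (M : Fin 3 → Matrix (Fin 3) (Fin 3) ℂ)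

/-- The coefficient vectors of the quadratic forms apolar to a net of matrices. -/
noncomputable def apolarQuadrics : Submodule ℂ (Fin 6 → ℂ) :=
  (Submodule.span ℂ (Set.range fun k => quadricPairing (M k))).dualCoannihilator

variable {M}

theorem mem_apolarQuadrics {x : Fin 6 → ℂ} :
    x ∈ apolarQuadrics M ↔ ∀ k, quadricPairing (M k) x = 0 := by
  rw [apolarQuadrics, Submodule.mem_dualCoannihilator]
  refine ⟨fun h k => h _ (Submodule.subset_span ⟨k, rfl⟩), fun h φ hφ => ?_⟩
  induction hφ using Submodule.span_induction with
  | mem φ hφ => obtain ⟨k, rfl⟩ := hφ; exact h k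
  | zero => simp
  | add φ ψ _ _ hφ hψ => simp [hφ, hψ]
  | smul y φ _ hφ => simp [hφ]

theorem quadricPairing_sum_smul (w : Fin 3 → ℂ) :
    quadricPairing (∑ k, w k • M k) = ∑ k, w k • quadricPairing (M k) := by
  simp

theorem finrank_span_add_finrank_apolarQuadrics :
    Module.finrank ℂ (Submodule.span ℂ (Set.range fun k => quadricPairing (M k))) +
      Module.finrank ℂ (apolarQuadrics M) = 6 := by
  rw [apolarQuadrics, Subspace.finrank_add_finrank_dualCoannihilator_eq]
  simp

/-- The quadratic forms apolar to a net of symmetric matrices form a three-dimensional space without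
nontrivial common zero iff the net has no nontrivial member of rank at most one. -/
theorem exists_basis_apolarQuadrics_iff (hM : ∀ k, (M k).IsSymm) :
    (∃ x : Fin 3 → Fin 6 → ℂ, LinearIndependent ℂ x ∧
        Submodule.span ℂ (Set.range x) = apolarQuadrics M ∧
        ∀ v, (∀ i, quadricPairing (vecMulVec v v) (x i) = 0) → v = 0) ↔
      ∀ w : Fin 3 → ℂ, (∑ k, w k • M k).adjugate = 0 → w = 0 := by
  have hsymm (w : Fin 3 → ℂ) : (∑ k, w k • M k).IsSymm :=
    isSymm_sum_smul hM w
  constructor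
  · rintro ⟨x, hx, hspan, hzero⟩ w hw
    obtain ⟨v, hv⟩ := exists_eq_vecMulVec_self_of_adjugate_eq_zero (hsymm w) hw
    have hv0 : v = 0 := by
      refine hzero v fun i => ?_
      have hi : x i ∈ apolarQuadrics M := hspan ▸ Submodule.subset_span ⟨i, rfl⟩
      rw [mem_apolarQuadrics] at hi
      simp [hv, hi]
    have hrank : Module.finrank ℂ (apolarQuadrics M) = 3 := by
      rw [← hspan, finrank_span_eq_card hx, Fintype.card_fin]
    have hindep : LinearIndependent ℂ fun k => quadricPairing (M k) := by
      rw [linearIndependent_iff_card_eq_finrank_span, Set.finrank, Fintype.card_fin]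
      have := finrank_span_add_finrank_apolarQuadrics (M := M)
      omega
    have hsum : ∑ k, w k • quadricPairing (M k) = 0 := by
      rw [← quadricPairing_sum_smul, ← hv, hv0]; simp
    exact funext (Fintype.linearIndependent_iff.mp hindep w hsum)
  · intro hw
    have hindep : LinearIndependent ℂ fun k => quadricPairing (M k) := by
      refine Fintype.linearIndependent_iff.mpr fun w h => congrFun (hw w ?_)
      rw [(hsymm w).ext_quadricPairing isSymm_zero (by rw [quadricPairing_sum_smul, h, map_zero]),
        adjugate_zero]
    have hrank : Module.finrank ℂ (apolarQuadrics M) = 3 := by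
      have := finrank_span_add_finrank_apolarQuadrics (M := M)
      rw [finrank_span_eq_card hindep, Fintype.card_fin] at this
      omega
    let B := Module.finBasisOfFinrankEq ℂ (apolarQuadrics M) hrank
    have hspan : Submodule.span ℂ (Set.range fun i => (B i : Fin 6 → ℂ)) = apolarQuadrics M := by
      have := congrArg (Submodule.map (apolarQuadrics M).subtype) B.span_eq
      rwa [Submodule.map_span, ← Set.range_comp, Submodule.map_top, Submodule.range_subtype] at this
    have hB : LinearIndependent ℂ fun i => (B i : Fin 6 → ℂ) :=
      B.linearIndependent.map' (apolarQuadrics M).subtype (Submodule.ker_subtype _)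
    refine ⟨fun i => B i, hB, hspan, fun v hv => ?_⟩
    have hle : apolarQuadrics M ≤ LinearMap.ker (quadricPairing (vecMulVec v v)) := by
      rw [← hspan, Submodule.span_le]
      rintro _ ⟨i, rfl⟩
      exact hv i
    have hmem : quadricPairing (vecMulVec v v) ∈
        Submodule.span ℂ (Set.range fun k => quadricPairing (M k)) := by
      refine mem_span_of_iInf_ker_le_ker fun x hx => hle (mem_apolarQuadrics.mpr ?_)
      simpa using hx
    obtain ⟨w, hwv⟩ := (Submodule.mem_span_range_iff_exists_fun ℂ).mp hmem
    have hvsymm : (vecMulVec v v).IsSymm := by rw [IsSymm, transpose_vecMulVec]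
    have heq : ∑ k, w k • M k = vecMulVec v v :=
      (hsymm w).ext_quadricPairing hvsymm (by rw [quadricPairing_sum_smul, hwv])
    have hw0 : w = 0 := hw w (by
      rw [heq]
      ext i j
      fin_cases i <;> fin_cases j <;> simp [adjugate_fin_three, vecMulVec_apply] <;> ring)
    funext i
    simpa [hw0, vecMulVec_apply] using (congrFun (congrFun heq i) i).symm

end LinearSystem

/-- For a ternary cubic `F` with coefficients `a,…,u` as displayed, the
degree four Aronhold invariant `A₄(F)` is nonzero iff `F^⊥ ∩ ℂ[z_1,z_2,z_3]_2` is
3-dimensional and admits a basis whose only common zero in `ℂ³` is the origin. -/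
theorem aronhold_A4_ne_zero_iff
    (a b c d p q r s t u : ℂ) :
    letI F : MvPolynomial (Fin 3) ℂ :=
      C a * X 0 ^ 3 + C b * X 1 ^ 3 + C c * X 2 ^ 3
        + C (3 * d) * X 0 ^ 2 * X 1 + C (3 * p) * X 0 ^ 2 * X 2
        + C (3 * q) * X 0 * X 1 ^ 2 + C (3 * r) * X 1 ^ 2 * X 2
        + C (3 * s) * X 0 * X 2 ^ 2 + C (3 * t) * X 1 * X 2 ^ 2
        + C (6 * u) * X 0 * X 1 * X 2
    letI A4 : ℂ :=
      a * b * c * u - b * c * d * p - a * c * q * r - a * b * s * t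
        - u * (a * r * t + b * p * s + c * d * q)
        + a * q * t ^ 2 + a * r ^ 2 * s + b * d * s ^ 2 + b * p ^ 2 * t
        + c * d ^ 2 * r + c * p * q ^ 2 - u ^ 4
        + 2 * u ^ 2 * (q * s + d * t + p * r)
        - 3 * u * (d * r * s + p * q * t)
        - q ^ 2 * s ^ 2 - d ^ 2 * t ^ 2 - p ^ 2 * r ^ 2
        + d * p * r * t + p * r * q * s + d * q * s * t
    (A4 ≠ 0 ↔
      ∃ f : Fin 3 → MvPolynomial (Fin 3) ℂ,
        LinearIndependent ℂ f
          ∧ (∀ i, (f i).IsHomogeneous 2)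
          ∧ (∀ i, diamond (f i) F = 0)
          ∧ (∀ g : MvPolynomial (Fin 3) ℂ,
              g.IsHomogeneous 2 → diamond g F = 0 →
                g ∈ Submodule.span ℂ (Set.range f))
          ∧ (∀ pt : Fin 3 → ℂ, (∀ i, eval pt (f i) = 0) → pt = 0)) := by
  change aronholdInvariant a b c d p q r s t u ≠ 0 ↔
    ∃ f : Fin 3 → MvPolynomial (Fin 3) ℂ, LinearIndependent ℂ f ∧ (∀ i, (f i).IsHomogeneous 2) ∧
      (∀ i, diamond (f i) (ternaryCubic a b c d p q r s t u) = 0) ∧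
      (∀ g : MvPolynomial (Fin 3) ℂ, g.IsHomogeneous 2 →
        diamond g (ternaryCubic a b c d p q r s t u) = 0 → g ∈ Submodule.span ℂ (Set.range f)) ∧
      ∀ pt : Fin 3 → ℂ, (∀ i, eval pt (f i) = 0) → pt = 0
  have hker : LinearMap.ker ternaryQuadric = ⊥ :=
    LinearMap.ker_eq_bot.mpr ternaryQuadric_injective
  have hapolar (x : Fin 6 → ℂ) : x ∈ apolarQuadrics (polarNet a b c d p q r s t u) ↔
      diamond (ternaryQuadric x) (ternaryCubic a b c d p q r s t u) = 0 := by
    rw [mem_apolarQuadrics, diamond_ternaryQuadric_ternaryCubic_eq_zero_iff]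
  have hmap (x : Fin 3 → Fin 6 → ℂ) (y : Fin 6 → ℂ) :
      ternaryQuadric y ∈ Submodule.span ℂ (Set.range fun i => ternaryQuadric (x i)) ↔
        y ∈ Submodule.span ℂ (Set.range x) := by
    rw [Set.range_comp' ternaryQuadric x, Submodule.span_image]
    simp [Submodule.mem_map, ternaryQuadric_injective.eq_iff]
  rw [aronholdInvariant_ne_zero_iff,
    ← exists_basis_apolarQuadrics_iff (polarNet_isSymm a b c d p q r s t u)]
  constructor
  · rintro ⟨x, hx, hspan, hzero⟩
    refine ⟨fun i => ternaryQuadric (x i), hx.map' _ hker,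
      fun i => ternaryQuadric_isHomogeneous _, fun i => ?_, fun g hg hgF => ?_, fun v hv => ?_⟩
    · exact (hapolar _).mp (hspan ▸ Submodule.subset_span ⟨i, rfl⟩)
    · obtain ⟨y, rfl⟩ := hg.exists_ternaryQuadric_eq
      rwa [hmap, hspan, hapolar]
    · exact hzero v fun i => by rw [← eval_ternaryQuadric, hv]
  · rintro ⟨f, hf, hhom, hdiamond, hspan, hzero⟩
    choose x hx using fun i => (hhom i).exists_ternaryQuadric_eq
    obtain rfl : (fun i => ternaryQuadric (x i)) = f := funext hx
    refine ⟨x, LinearIndependent.of_comp ternaryQuadric hf, le_antisymm ?_ fun y hy => ?_,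
      fun v hv => hzero v fun i => by rw [eval_ternaryQuadric, hv]⟩
    · rw [Submodule.span_le]
      rintro _ ⟨i, rfl⟩
      exact (hapolar _).mpr (hdiamond i)
    · exact (hmap x y).mp (hspan _ (ternaryQuadric_isHomogeneous y) ((hapolar y).mp hy))
end

section
/- Let t ∈ ℂ with t³ ≠ −27, and let c_t := z_1³ + z_2³ + z_3³ + t·z_1z_2z_3 ∈ ℂ[z_1,z_2,z_3]_3. Then c_t is nondegenerate, and the associated form of c_t equals −(1/(24(t³+27)))·(t·e_1³ + t·e_2³ + t·e_3³ − 18·e_1e_2e_3). -/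
open MvPolynomial

noncomputable section

/-- The gradient ideal `(f_{z_1},…,f_{z_n})` of a form `f`. -/
def gradIdeal (n : ℕ) (f : MvPolynomial (Fin n) ℂ) : Ideal (MvPolynomial (Fin n) ℂ) :=
  Ideal.span (Set.range fun i => pderiv i f)

/-- The Hessian `det (∂²f/∂z_i∂z_j)` of a form `f`. -/
def hess (n : ℕ) (f : MvPolynomial (Fin n) ℂ) : MvPolynomial (Fin n) ℂ :=
  Matrix.det (Matrix.of fun i j : Fin n => pderiv i (pderiv j f))

/-- `μ` is the system of coefficients defining the associated form of `f`:
for each multi-index `m` with `|m| = n(d-2)`, the scalar `μ m` satisfies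
`z^m - μ m · Hess f ∈ (f_{z_1},…,f_{z_n})`. -/
def IsAssocCoeffs (n d : ℕ) (f : MvPolynomial (Fin n) ℂ) (μ : (Fin n → ℕ) → ℂ) : Prop :=
  ∀ m : Fin n → ℕ, (∑ i, m i) = n * (d - 2) →
    (∏ i, X i ^ m i) - C (μ m) * hess n f ∈ gradIdeal n f

/-- The associated form `Σ_{|m| = n(d-2)} (n(d-2))!/(m_1!⋯m_n!) · μ m · e^m`
built from the coefficients `μ`. -/
def assocForm (n d : ℕ) (μ : (Fin n → ℕ) → ℂ) : MvPolynomial (Fin n) ℂ :=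
  ∑ m ∈ Finset.Nat.antidiagonalTuple n (n * (d - 2)),
    C ((Nat.multinomial Finset.univ m : ℂ) * μ m) * ∏ i, X i ^ m i

end
noncomputable section

/-- The cubic `c_t = z_1³ + z_2³ + z_3³ + t z_1z_2z_3`. -/
def hesseCubic (t : ℂ) : MvPolynomial (Fin 3) ℂ :=
  X 0 ^ 3 + X 1 ^ 3 + X 2 ^ 3 + C t * (X 0 * X 1 * X 2)

/-- The differential operator `t ∂_1³ + t ∂_2³ + t ∂_3³ - 18 ∂_1∂_2∂_3`, evaluated at the origin. -/
def hesseFunctional (t : ℂ) (p : MvPolynomial (Fin 3) ℂ) : ℂ :=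
  eval 0 (C t * (pderiv 0 (pderiv 0 (pderiv 0 p)) + pderiv 1 (pderiv 1 (pderiv 1 p))
    + pderiv 2 (pderiv 2 (pderiv 2 p))) - C 18 * pderiv 0 (pderiv 1 (pderiv 2 p)))

end

lemma MvPolynomial.pderiv_ofNat {σ R : Type*} [CommSemiring R] (i : σ) (n : ℕ) [n.AtLeastTwo] :
    pderiv i (ofNat(n) : MvPolynomial σ R) = 0 :=
  (pderiv i).map_natCast n

lemma pderiv_zero_hesseCubic (t : ℂ) :
    pderiv 0 (hesseCubic t) = C 3 * X 0 ^ 2 + C t * (X 1 * X 2) := by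
  simp [hesseCubic, pderiv_X, Derivation.leibniz, Derivation.leibniz_pow, map_ofNat, mul_comm]

lemma pderiv_one_hesseCubic (t : ℂ) :
    pderiv 1 (hesseCubic t) = C 3 * X 1 ^ 2 + C t * (X 0 * X 2) := by
  simp [hesseCubic, pderiv_X, Derivation.leibniz, Derivation.leibniz_pow, map_ofNat, mul_comm]

lemma pderiv_two_hesseCubic (t : ℂ) :
    pderiv 2 (hesseCubic t) = C 3 * X 2 ^ 2 + C t * (X 0 * X 1) := by
  simp [hesseCubic, pderiv_X, Derivation.leibniz, Derivation.leibniz_pow, map_ofNat, mul_comm]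

lemma hess_hesseCubic (t : ℂ) :
    hess 3 (hesseCubic t) = C (216 + 2 * t ^ 3) * (X 0 * X 1 * X 2)
      - C (6 * t ^ 2) * (X 0 ^ 3 + X 1 ^ 3 + X 2 ^ 3) := by
  simp [hess, Matrix.det_fin_three, pderiv_zero_hesseCubic, pderiv_one_hesseCubic,
    pderiv_two_hesseCubic, pderiv_X, pderiv_ofNat, Derivation.leibniz, Derivation.leibniz_pow,
    map_ofNat]
  ring

lemma hesseFunctional_sub (t : ℂ) (p q : MvPolynomial (Fin 3) ℂ) :
    hesseFunctional t (p - q) = hesseFunctional t p - hesseFunctional t q := by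
  simp [hesseFunctional]
  ring

lemma hesseFunctional_C_mul (t a : ℂ) (p : MvPolynomial (Fin 3) ℂ) :
    hesseFunctional t (C a * p) = a * hesseFunctional t p := by
  simp [hesseFunctional]
  ring

lemma hesseFunctional_hess (t : ℂ) :
    hesseFunctional t (hess 3 (hesseCubic t)) = -(144 * (t ^ 3 + 27)) := by
  simp [hess_hesseCubic, hesseFunctional, pderiv_X, pderiv_ofNat, Derivation.leibniz,
    Derivation.leibniz_pow, map_ofNat]
  ring

lemma hesseFunctional_eq_zero_of_mem_gradIdeal {t : ℂ} {p : MvPolynomial (Fin 3) ℂ}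
    (hp : p ∈ gradIdeal 3 (hesseCubic t)) : hesseFunctional t p = 0 := by
  obtain ⟨q, rfl⟩ := (Submodule.mem_span_range_iff_exists_fun _).1 hp
  simp [Fin.sum_univ_three, pderiv_zero_hesseCubic, pderiv_one_hesseCubic,
    pderiv_two_hesseCubic, hesseFunctional, pderiv_X, pderiv_ofNat, Derivation.leibniz,
    Derivation.leibniz_pow, map_ofNat]
  ring

/-- The functional determines the coefficients of the associated form. -/
lemma IsAssocCoeffs.eq_hesseFunctional_div {t : ℂ} (ht : t ^ 3 + 27 ≠ 0) {μ : (Fin 3 → ℕ) → ℂ}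
    (hμ : IsAssocCoeffs 3 3 (hesseCubic t) μ) {m : Fin 3 → ℕ} (hm : ∑ i, m i = 3) :
    μ m = -(hesseFunctional t (∏ i, X i ^ m i) / (144 * (t ^ 3 + 27))) := by
  have h := hesseFunctional_eq_zero_of_mem_gradIdeal (hμ m hm)
  rw [hesseFunctional_sub, hesseFunctional_C_mul, hesseFunctional_hess] at h
  field_simp
  linear_combination h

lemma eq_zero_of_eval_pderiv_hesseCubic {t : ℂ} (ht : t ^ 3 + 27 ≠ 0) {p : Fin 3 → ℂ}
    (hp : ∀ i, eval p (pderiv i (hesseCubic t)) = 0) : p = 0 := by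
  have h0 := hp 0
  have h1 := hp 1
  have h2 := hp 2
  simp only [pderiv_zero_hesseCubic, pderiv_one_hesseCubic, pderiv_two_hesseCubic, map_add,
    map_mul, map_pow, eval_C, eval_X] at h0 h1 h2
  have hprod : p 0 * p 1 * p 2 = 0 := by
    have : (t ^ 3 + 27) * (p 0 * p 1 * p 2) ^ 2 = 0 := by
      linear_combination 9 * p 1 ^ 2 * p 2 ^ 2 * h0 - 3 * t * p 1 * p 2 ^ 3 * h1
        + t ^ 2 * p 0 * p 1 * p 2 ^ 2 * h2
    simpa [ht] using this
  funext i
  have : p i ^ 3 = 0 := by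
    fin_cases i <;> simp only [Fin.zero_eta, Fin.mk_one, Fin.reduceFinMk]
    · linear_combination (p 0 * h0 - t * hprod) / 3
    · linear_combination (p 1 * h1 - t * hprod) / 3
    · linear_combination (p 2 * h2 - t * hprod) / 3
  simpa using this

lemma antidiagonalTuple_three_three :
    Finset.Nat.antidiagonalTuple 3 3 = {![3, 0, 0], ![0, 3, 0], ![0, 0, 3], ![1, 1, 1],
      ![2, 1, 0], ![2, 0, 1], ![1, 2, 0], ![0, 2, 1], ![1, 0, 2], ![0, 1, 2]} := by
  decide

lemma assocForm_hesseCubic {t : ℂ} (ht : t ^ 3 + 27 ≠ 0) {μ : (Fin 3 → ℕ) → ℂ}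
    (hμ : IsAssocCoeffs 3 3 (hesseCubic t) μ) :
    assocForm 3 3 μ = C (-(1 / (24 * (t ^ 3 + 27))))
      * (C t * X 0 ^ 3 + C t * X 1 ^ 3 + C t * X 2 ^ 3 - C 18 * (X 0 * X 1 * X 2)) := by
  have hsum : assocForm 3 3 μ = ∑ m ∈ Finset.Nat.antidiagonalTuple 3 3,
      C (Nat.multinomial Finset.univ m * -(hesseFunctional t (∏ i, X i ^ m i)
        / (144 * (t ^ 3 + 27)))) * ∏ i, X i ^ m i :=
    Finset.sum_congr rfl fun m hm => by
      rw [hμ.eq_hesseFunctional_div ht (Finset.Nat.mem_antidiagonalTuple.1 hm)]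
  rw [hsum, antidiagonalTuple_three_three]
  repeat rw [Finset.sum_insert (by decide)]
  rw [Finset.sum_singleton]
  simp [Nat.multinomial, Fin.prod_univ_three, Fin.sum_univ_three, hesseFunctional, pderiv_X,
    pderiv_ofNat, Derivation.leibniz, Derivation.leibniz_pow, map_ofNat, Nat.factorial]
  have hcube : t * (3 * 2) / (144 * (t ^ 3 + 27)) = (t ^ 3 + 27)⁻¹ * 24⁻¹ * t := by
    field_simp
    ring
  have hprod : -18 / (144 * (t ^ 3 + 27)) = -((t ^ 3 + 27)⁻¹ * 24⁻¹ * 3) := by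
    field_simp
    norm_num
  rw [hcube, hprod]
  simp only [map_neg, map_mul, map_ofNat]
  ring

/-- For `t³ ≠ -27`, the ternary cubic `c_t = z_1³ + z_2³ + z_3³ + t z_1z_2z_3`
is nondegenerate and its associated form is
`-(1/(24(t³+27)))(t e_1³ + t e_2³ + t e_3³ - 18 e_1e_2e_3)`. -/
theorem assocForm_of_ternary_cubic_ct
    (t : ℂ) (ht : t ^ 3 ≠ -27) :
    letI c : MvPolynomial (Fin 3) ℂ := X 0 ^ 3 + X 1 ^ 3 + X 2 ^ 3 + C t * (X 0 * X 1 * X 2)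
    (∀ p : Fin 3 → ℂ, (∀ i, eval p (pderiv i c) = 0) → p = 0)
      ∧ ∀ μ : (Fin 3 → ℕ) → ℂ, IsAssocCoeffs 3 3 c μ →
          assocForm 3 3 μ
            = C (-(1 / (24 * (t ^ 3 + 27))))
                * (C t * X 0 ^ 3 + C t * X 1 ^ 3 + C t * X 2 ^ 3
                    - C 18 * (X 0 * X 1 * X 2)) := by
  have ht' : t ^ 3 + 27 ≠ 0 := fun h => ht (eq_neg_of_add_eq_zero_left h)
  exact ⟨fun _ hp => eq_zero_of_eval_pderiv_hesseCubic ht' hp,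
    fun _ hμ => assocForm_hesseCubic ht' hμ⟩
end
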